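/- Let n ≥ 2. An element w ∈ G(∞,∞,n) is balanced and of maximal length ℓ(w) = n(n−1) if and only if w = λ^k for some nonzero integer k. -/

import Mathlib

/-- The indeterminate `x` in the field `K = ℚ(x)` of rational functions over `ℚ`. -/
noncomputable def xx : RatFunc ℚ := RatFunc.X

/-- Membership in `G(∞,∞,n)`: a monomial matrix whose nonzero entries are integer powers
of `x` and such that the product of the nonzero entries is `1`. -/
def IsGinf (n : ℕ) (w : Matrix (Fin n) (Fin n) (RatFunc ℚ)) : Prop :=
  (∀ i : Fin n, ∃! c : Fin n, w i c ≠ 0) ∧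
  (∀ c : Fin n, ∃! i : Fin n, w i c ≠ 0) ∧
  (∀ i c : Fin n, w i c ≠ 0 → ∃ k : ℤ, w i c = xx ^ k) ∧
  (∏ i : Fin n, ∑ c : Fin n, w i c) = 1

/-- The generator `t_i` (1-indexed rows/columns 1,2 are `Fin` indices 0,1). -/
noncomputable def tMat (n : ℕ) (i : ℤ) : Matrix (Fin n) (Fin n) (RatFunc ℚ) :=
  fun r c =>
    if r.val = 0 ∧ c.val = 1 then xx ^ (-i)
    else if r.val = 1 ∧ c.val = 0 then xx ^ i
    else if r = c ∧ 2 ≤ r.val then 1 else 0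

/-- The generator `s_j` (`3 ≤ j ≤ n`): permutation matrix of the transposition exchanging
coordinates `j-1` and `j` (1-indexed), i.e. `Fin` indices `j-2` and `j-1`. -/
noncomputable def sMat (n : ℕ) (j : ℕ) : Matrix (Fin n) (Fin n) (RatFunc ℚ) :=
  fun r c =>
    if (r.val + 2 = j ∧ c.val + 1 = j) ∨ (r.val + 1 = j ∧ c.val + 2 = j) ∨
       (r = c ∧ r.val + 2 ≠ j ∧ r.val + 1 ≠ j) then 1 else 0

/-- The generating set `X = {t_i : i ∈ ℤ} ∪ {s_j : 3 ≤ j ≤ n}`. -/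
def Xset (n : ℕ) : Set (Matrix (Fin n) (Fin n) (RatFunc ℚ)) :=
  {w | (∃ i : ℤ, w = tMat n i) ∨ (∃ j : ℕ, 3 ≤ j ∧ j ≤ n ∧ w = sMat n j)}

/-- `len n w` is the minimal `m` such that `w` is a product of `m` elements of `X`. -/
noncomputable def len (n : ℕ) (w : Matrix (Fin n) (Fin n) (RatFunc ℚ)) : ℕ :=
  sInf {m | ∃ L : List (Matrix (Fin n) (Fin n) (RatFunc ℚ)),
    L.length = m ∧ (∀ a ∈ L, a ∈ Xset n) ∧ L.prod = w}

/-- Left divisibility: `v ⪯ w` iff `ℓ(v) + ℓ(v⁻¹ w) = ℓ(w)`. -/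
def preL (n : ℕ) (v w : Matrix (Fin n) (Fin n) (RatFunc ℚ)) : Prop :=
  len n v + len n (v⁻¹ * w) = len n w

/-- Right divisibility: `v ⪯_r w` iff `ℓ(w v⁻¹) + ℓ(v) = ℓ(w)`. -/
def preR (n : ℕ) (v w : Matrix (Fin n) (Fin n) (RatFunc ℚ)) : Prop :=
  len n (w * v⁻¹) + len n v = len n w

/-- The element `λ = diag(x^{-(n-1)}, x, …, x)`. -/
noncomputable def lam (n : ℕ) : Matrix (Fin n) (Fin n) (RatFunc ℚ) :=
  Matrix.diagonal (fun i => if i.val = 0 then xx ^ (-((n : ℤ) - 1)) else xx)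

open Equiv

lemma xx_ne_zero : xx ≠ 0 := RatFunc.X_ne_zero

lemma xx_zpow_ne_zero (k : ℤ) : xx ^ k ≠ 0 := zpow_ne_zero k xx_ne_zero

lemma xx_zpow_sum {ι : Type*} (s : Finset ι) (a : ι → ℤ) :
    xx ^ (∑ i ∈ s, a i) = ∏ i ∈ s, xx ^ a i := by
  induction s using Finset.cons_induction with
  | empty => simp
  | cons i s hi ih => rw [Finset.sum_cons, Finset.prod_cons, zpow_add₀ xx_ne_zero, ih]

lemma xx_pow_eq_one {m : ℕ} (h : xx ^ m = 1) : m = 0 := by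
  have h1 : (Polynomial.X ^ m : Polynomial ℚ) = 1 := by
    apply RatFunc.algebraMap_injective ℚ
    rw [map_pow, RatFunc.algebraMap_X, map_one]
    exact h
  simpa using congrArg Polynomial.natDegree h1

lemma xx_zpow_eq_one {k : ℤ} (h : xx ^ k = 1) : k = 0 := by
  obtain ⟨m, rfl | rfl⟩ := Int.eq_nat_or_neg k
  · rw [zpow_natCast] at h
    simp [xx_pow_eq_one h]
  · rw [zpow_neg, inv_eq_one, zpow_natCast] at h
    simp [xx_pow_eq_one h]

variable {n : ℕ}

/-- The monomial matrix with entry `x ^ a r` at position `(r, σ r)`. -/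
noncomputable def monoMat (σ : Perm (Fin n)) (a : Fin n → ℤ) :
    Matrix (Fin n) (Fin n) (RatFunc ℚ) :=
  fun r c => if c = σ r then xx ^ a r else 0

lemma monoMat_mul (σ τ : Perm (Fin n)) (a b : Fin n → ℤ) :
    monoMat σ a * monoMat τ b = monoMat (τ * σ) (fun r => a r + b (σ r)) := by
  ext r c
  rw [Matrix.mul_apply, Finset.sum_eq_single (σ r)]
  · simp only [monoMat, if_true, Perm.mul_apply]
    by_cases hc : c = τ (σ r)
    · simp [hc, zpow_add₀ xx_ne_zero]
    · simp [hc]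
  · intro d _ hd
    simp [monoMat, hd]
  · simp

lemma monoMat_one_eq_diagonal (a : Fin n → ℤ) :
    monoMat 1 a = Matrix.diagonal fun i => xx ^ a i := by
  ext r c
  simp [monoMat, Matrix.diagonal_apply, eq_comm]

lemma monoMat_one_zero : monoMat (1 : Perm (Fin n)) 0 = 1 := by
  rw [monoMat_one_eq_diagonal]
  simp

lemma monoMat_inv (σ : Perm (Fin n)) (a : Fin n → ℤ) :
    (monoMat σ a)⁻¹ = monoMat σ⁻¹ (fun r => -a (σ⁻¹ r)) := by
  apply Matrix.inv_eq_right_inv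
  rw [monoMat_mul, ← monoMat_one_zero]
  congr 1
  · simp
  · funext r
    simp

lemma IsGinf.exists_monoMat {w : Matrix (Fin n) (Fin n) (RatFunc ℚ)} (hw : IsGinf n w) :
    ∃ (σ : Perm (Fin n)) (a : Fin n → ℤ), ∑ i, a i = 0 ∧ w = monoMat σ a := by
  obtain ⟨h1, h2, h3, h4⟩ := hw
  choose f hf hf' using h1
  have hinj : Function.Injective f := by
    intro i j hij
    exact (h2 (f i)).unique (hf i) (by simpa only [hij] using hf j)
  choose a ha using fun i => h3 i (f i) (hf i)
  let σ : Perm (Fin n) := Equiv.ofBijective f (Finite.injective_iff_bijective.mp hinj)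
  have hσ : w = monoMat σ a := by
    ext r c
    have hr : σ r = f r := rfl
    by_cases hc : c = f r
    · simp [monoMat, hr, hc, ha]
    · simp only [monoMat, hr, hc, if_false]
      by_contra h
      exact hc (hf' r c h)
  refine ⟨σ, a, ?_, hσ⟩
  apply xx_zpow_eq_one
  rw [← h4, hσ]
  simp [xx_zpow_sum, monoMat]

lemma isGinf_monoMat (σ : Perm (Fin n)) (a : Fin n → ℤ) (ha : ∑ i, a i = 0) :
    IsGinf n (monoMat σ a) := by
  refine ⟨fun i => ⟨σ i, ?_, ?_⟩, fun c => ⟨σ⁻¹ c, ?_, ?_⟩, ?_, ?_⟩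
  · simp [monoMat, xx_zpow_ne_zero]
  · intro c hc
    by_contra h
    exact hc (by simp [monoMat, h])
  · simp [monoMat, xx_zpow_ne_zero]
  · intro i hi
    by_contra h
    refine hi ?_
    simp only [monoMat]
    rw [if_neg]
    rintro rfl
    simp at h
  · intro i c h
    refine ⟨a i, ?_⟩
    simp only [monoMat] at h ⊢
    split_ifs at h ⊢ <;> simp_all
  · simp [monoMat, ← xx_zpow_sum, ha]

/-- The exponents of the generator `t_k`. -/
def genExp (k : ℤ) : Fin n → ℤ :=
  fun r => if r.val = 0 then -k else if r.val = 1 then k else 0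

lemma genExp_zero : genExp (n := n) 0 = 0 := by
  funext r
  simp [genExp]

/-- The generators, in the form (adjacent transposition, exponents). -/
noncomputable def genMat (c : ℕ) (h : c + 1 < n) (k : ℤ) : Matrix (Fin n) (Fin n) (RatFunc ℚ) :=
  monoMat (swap ⟨c, by omega⟩ ⟨c + 1, h⟩) (genExp k)

lemma tMat_eq (h : 0 + 1 < n) (k : ℤ) : tMat n k = genMat 0 h k := by
  ext r c
  simp only [tMat, genMat, monoMat, genExp, swap_apply_def, Fin.ext_iff]
  split_ifs <;> first | rfl | (exfalso; (try dsimp only at *); omega)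

lemma sMat_eq (c : ℕ) (h : c + 1 < n) : sMat n (c + 2) = genMat c h 0 := by
  ext r d
  simp only [sMat, genMat, monoMat, genExp_zero, swap_apply_def, Fin.ext_iff, Pi.zero_apply,
    zpow_zero]
  congr 1
  apply propext
  split_ifs <;> grind

lemma mem_Xset_iff (hn : 2 ≤ n) (g : Matrix (Fin n) (Fin n) (RatFunc ℚ)) :
    g ∈ Xset n ↔ ∃ (c : ℕ) (h : c + 1 < n) (k : ℤ), (k ≠ 0 → c = 0) ∧ g = genMat c h k := by
  constructor
  · rintro (⟨k, rfl⟩ | ⟨j, hj, hjn, rfl⟩)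
    · exact ⟨0, by omega, k, fun _ => rfl, tMat_eq _ k⟩
    · obtain ⟨c, rfl⟩ := Nat.exists_eq_add_of_le' (show 2 ≤ j by omega)
      exact ⟨c, by omega, 0, by simp, sMat_eq c _⟩
  · rintro ⟨c, h, k, hk, rfl⟩
    by_cases hc : c = 0
    · subst hc
      exact Or.inl ⟨k, (tMat_eq h k).symm⟩
    · obtain rfl : k = 0 := by_contra fun h0 => hc (hk h0)
      exact Or.inr ⟨c + 2, by omega, by omega, (sMat_eq c h).symm⟩

lemma genExp_add_swap {c : ℕ} (h : c + 1 < n) {k : ℤ} (hk : k ≠ 0 → c = 0) (r : Fin n) :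
    genExp k r + genExp k (swap ⟨c, by omega⟩ ⟨c + 1, h⟩ r) = 0 := by
  by_cases h0 : k = 0
  · simp [h0, genExp_zero]
  · obtain rfl := hk h0
    simp only [genExp, swap_apply_def, Fin.ext_iff]
    split_ifs <;> simp_all

lemma genMat_mul_self {c : ℕ} (h : c + 1 < n) {k : ℤ} (hk : k ≠ 0 → c = 0) :
    genMat c h k * genMat c h k = 1 := by
  rw [genMat, monoMat_mul, ← monoMat_one_zero]
  congr 1
  · simp
  · funext r
    exact genExp_add_swap h hk r

lemma sum_genExp (hn : 2 ≤ n) (k : ℤ) : ∑ i : Fin n, genExp k i = 0 := by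
  obtain ⟨m, rfl⟩ := Nat.exists_eq_add_of_le' hn
  simp [Fin.sum_univ_succ, genExp]

/-- The contribution of a pair of rows to the length of `monoMat σ a`. -/
def pairWeight (σ : Perm (Fin n)) (a : Fin n → ℤ) (p : Fin n × Fin n) : ℕ :=
  if p.1 < p.2 then (if σ p.2 < σ p.1 then 1 else if a p.2 ≠ 0 then 2 else 0) else 0

/-- The closed formula for the length of `monoMat σ a`. -/
def weight (σ : Perm (Fin n)) (a : Fin n → ℤ) : ℕ := ∑ p, pairWeight σ a p

lemma weight_one_zero : weight (1 : Perm (Fin n)) 0 = 0 := by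
  refine Finset.sum_eq_zero fun p _ => ?_
  simp only [pairWeight, Perm.one_apply, Pi.zero_apply]
  split_ifs <;> first | rfl | omega | simp_all

lemma weight_add_pairWeight {σ τ : Perm (Fin n)} {a b : Fin n → ℤ} (p : Fin n × Fin n)
    (h : ∀ q, q ≠ p → pairWeight σ a q = pairWeight τ b q) :
    weight σ a + pairWeight τ b p = weight τ b + pairWeight σ a p := by
  have h1 := Finset.add_sum_erase Finset.univ (pairWeight σ a) (Finset.mem_univ p)
  have h2 := Finset.add_sum_erase Finset.univ (pairWeight τ b) (Finset.mem_univ p)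
  have h3 : ∑ q ∈ Finset.univ.erase p, pairWeight σ a q =
      ∑ q ∈ Finset.univ.erase p, pairWeight τ b q :=
    Finset.sum_congr rfl fun q hq => h q (Finset.ne_of_mem_erase hq)
  simp only [weight]
  omega

lemma swap_succ_lt_iff {c : ℕ} (h : c + 1 < n) {u v : Fin n} (h1 : ¬ (u.val = c ∧ v.val = c + 1))
    (h2 : ¬ (u.val = c + 1 ∧ v.val = c)) :
    swap ⟨c, by omega⟩ ⟨c + 1, h⟩ u < swap ⟨c, by omega⟩ ⟨c + 1, h⟩ v ↔ u < v := by
  simp only [swap_apply_def, Fin.ext_iff, Fin.lt_def]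
  split_ifs <;> grind

/-- The permutation of `monoMat σ a * genMat c h k`. -/
def stepPerm (c : ℕ) (h : c + 1 < n) (σ : Perm (Fin n)) : Perm (Fin n) :=
  swap ⟨c, by omega⟩ ⟨c + 1, h⟩ * σ

/-- The exponents of `monoMat σ a * genMat c h k`. -/
def stepExp (k : ℤ) (σ : Perm (Fin n)) (a : Fin n → ℤ) : Fin n → ℤ :=
  fun r => a r + genExp k (σ r)

lemma monoMat_mul_genMat (c : ℕ) (h : c + 1 < n) (k : ℤ) (σ : Perm (Fin n)) (a : Fin n → ℤ) :
    monoMat σ a * genMat c h k = monoMat (stepPerm c h σ) (stepExp k σ a) :=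
  monoMat_mul _ _ _ _

lemma sum_stepExp (hn : 2 ≤ n) (k : ℤ) (σ : Perm (Fin n)) (a : Fin n → ℤ) :
    ∑ i, stepExp k σ a i = ∑ i, a i := by
  simp only [stepExp, Finset.sum_add_distrib]
  rw [Equiv.sum_comp σ (genExp k), sum_genExp hn, add_zero]

lemma pairWeight_step {c : ℕ} (h : c + 1 < n) {k : ℤ} (hk : k ≠ 0 → c = 0) (σ : Perm (Fin n))
    (a : Fin n → ℤ) (q : Fin n × Fin n) (h1 : ¬ ((σ q.1).val = c ∧ (σ q.2).val = c + 1))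
    (h2 : ¬ ((σ q.1).val = c + 1 ∧ (σ q.2).val = c)) :
    pairWeight (stepPerm c h σ) (stepExp k σ a) q = pairWeight σ a q := by
  have hlt : stepPerm c h σ q.2 < stepPerm c h σ q.1 ↔ σ q.2 < σ q.1 :=
    swap_succ_lt_iff h (by tauto) (by tauto)
  simp only [pairWeight, hlt]
  by_cases hq : q.1 < q.2
  swap
  · simp [hq]
  by_cases hs : σ q.2 < σ q.1
  · simp [hs]
  have hne : σ q.1 ≠ σ q.2 := fun e => hq.ne (σ.injective e)
  have hlt : (σ q.1).val < (σ q.2).val := lt_of_le_of_ne (not_lt.mp hs) (Fin.val_ne_of_ne hne)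
  have : genExp k (σ q.2) = 0 := by
    by_cases h0 : k = 0
    · simp [h0, genExp_zero]
    · have := hk h0
      simp only [genExp]
      rw [if_neg (by omega), if_neg (by omega)]
  simp [stepExp, this]

lemma weight_step_of_lt {c : ℕ} (h : c + 1 < n) {k : ℤ} (hk : k ≠ 0 → c = 0) {σ : Perm (Fin n)}
    (a : Fin n → ℤ) {p q : Fin n} (hp : (σ p).val = c) (hq : (σ q).val = c + 1) (hpq : p < q) :
    weight (stepPerm c h σ) (stepExp k σ a) + (if a q ≠ 0 then 2 else 0) = weight σ a + 1 := by
  have hp' : σ p = ⟨c, by omega⟩ := Fin.ext hp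
  have hq' : σ q = ⟨c + 1, h⟩ := Fin.ext hq
  have key := weight_add_pairWeight (σ := stepPerm c h σ) (τ := σ) (a := stepExp k σ a) (b := a)
    (p, q) fun r hr => by
      by_cases hlt : r.1 < r.2
      · apply pairWeight_step h hk
        · rintro ⟨e1, e2⟩
          apply hr
          ext1
          · exact σ.injective (Fin.ext (e1.trans hp.symm))
          · exact σ.injective (Fin.ext (e2.trans hq.symm))
        · rintro ⟨e1, e2⟩
          have f1 : r.1 = q := σ.injective (Fin.ext (e1.trans hq.symm))
          have f2 : r.2 = p := σ.injective (Fin.ext (e2.trans hp.symm))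
          rw [f1, f2] at hlt
          exact lt_asymm hlt hpq
      · simp [pairWeight, hlt]
  simpa [pairWeight, stepPerm, hpq, hp', hq', Fin.lt_def] using key

lemma weight_step_of_gt {c : ℕ} (h : c + 1 < n) {k : ℤ} (hk : k ≠ 0 → c = 0) {σ : Perm (Fin n)}
    (a : Fin n → ℤ) {p q : Fin n} (hp : (σ p).val = c) (hq : (σ q).val = c + 1) (hpq : q < p) :
    weight (stepPerm c h σ) (stepExp k σ a) + 1 =
      weight σ a + (if stepExp k σ a p ≠ 0 then 2 else 0) := by
  have hp' : σ p = ⟨c, by omega⟩ := Fin.ext hp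
  have hq' : σ q = ⟨c + 1, h⟩ := Fin.ext hq
  have key := weight_add_pairWeight (σ := stepPerm c h σ) (τ := σ) (a := stepExp k σ a) (b := a)
    (q, p) fun r hr => by
      by_cases hlt : r.1 < r.2
      · apply pairWeight_step h hk
        · rintro ⟨e1, e2⟩
          have f1 : r.1 = p := σ.injective (Fin.ext (e1.trans hp.symm))
          have f2 : r.2 = q := σ.injective (Fin.ext (e2.trans hq.symm))
          rw [f1, f2] at hlt
          exact lt_asymm hlt hpq
        · rintro ⟨e1, e2⟩
          apply hr
          ext1
          · exact σ.injective (Fin.ext (e1.trans hq.symm))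
          · exact σ.injective (Fin.ext (e2.trans hp.symm))
      · simp [pairWeight, hlt]
  simpa [pairWeight, stepPerm, hpq, hp', hq', Fin.lt_def] using key

lemma exists_preimages (σ : Perm (Fin n)) {c : ℕ} (h : c + 1 < n) :
    ∃ p q, (σ p).val = c ∧ (σ q).val = c + 1 ∧ p ≠ q := by
  refine ⟨σ⁻¹ ⟨c, by omega⟩, σ⁻¹ ⟨c + 1, h⟩, by simp, by simp, ?_⟩
  simp

lemma weight_step_le {c : ℕ} (h : c + 1 < n) {k : ℤ} (hk : k ≠ 0 → c = 0) (σ : Perm (Fin n))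
    (a : Fin n → ℤ) : weight (stepPerm c h σ) (stepExp k σ a) ≤ weight σ a + 1 := by
  obtain ⟨p, q, hp, hq, hne⟩ := exists_preimages σ h
  rcases lt_or_gt_of_ne hne with hlt | hlt
  · have := weight_step_of_lt h hk a hp hq hlt
    omega
  · have := weight_step_of_gt h hk a hp hq hlt
    split_ifs at this <;> omega

lemma Equiv.Perm.eq_one_of_strictMono {σ : Perm (Fin n)} (h : StrictMono σ) : σ = 1 := by
  have : (StrictMono.orderIsoOfSurjective σ h σ.surjective) = OrderIso.refl (Fin n) :=
    Subsingleton.elim _ _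
  ext i
  exact congrArg (fun f : Fin n ≃o Fin n => (f i).val) this

lemma exists_descent (hn : 2 ≤ n) (σ : Perm (Fin n)) (a : Fin n → ℤ) (ha : ∑ i, a i = 0)
    (hne : ¬ (σ = 1 ∧ a = 0)) :
    ∃ (c : ℕ) (h : c + 1 < n) (k : ℤ), (k ≠ 0 → c = 0) ∧
      weight (stepPerm c h σ) (stepExp k σ a) + 1 = weight σ a := by
  by_contra! hcon
  have key : ∀ (c : ℕ) (h : c + 1 < n), σ⁻¹ ⟨c, by omega⟩ < σ⁻¹ ⟨c + 1, h⟩ ∧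
      a (σ⁻¹ ⟨c + 1, h⟩) = 0 := by
    intro c
    induction c with
    | zero =>
      intro h
      obtain ⟨p, q, hp, hq, hne⟩ := exists_preimages σ h
      have hp' : σ⁻¹ ⟨0, by omega⟩ = p := Perm.inv_eq_iff_eq.mpr (Fin.ext hp.symm)
      have hq' : σ⁻¹ ⟨0 + 1, h⟩ = q := Perm.inv_eq_iff_eq.mpr (Fin.ext hq.symm)
      rw [hp', hq']
      rcases lt_or_gt_of_ne hne with hlt | hlt
      · refine ⟨hlt, by_contra fun h0 => ?_⟩
        have h1 := weight_step_of_lt h (k := 0) (by simp) a hp hq hlt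
        have h2 := hcon 0 h 0 (by simp)
        rw [if_pos h0] at h1
        omega
      · have h1 := weight_step_of_gt h (k := a p) (by simp) a hp hq hlt
        have h2 := hcon 0 h (a p) (by simp)
        rw [if_neg (by simp [stepExp, genExp, hp])] at h1
        omega
    | succ c ih =>
      intro h
      obtain ⟨-, ih⟩ := ih (by omega)
      obtain ⟨p, q, hp, hq, hne⟩ := exists_preimages σ h
      have hp' : σ⁻¹ ⟨c + 1, by omega⟩ = p := Perm.inv_eq_iff_eq.mpr (Fin.ext hp.symm)
      have hq' : σ⁻¹ ⟨c + 1 + 1, h⟩ = q := Perm.inv_eq_iff_eq.mpr (Fin.ext hq.symm)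
      rw [hp'] at ih
      rw [hp', hq']
      have h2 := hcon (c + 1) h 0 (by simp)
      rcases lt_or_gt_of_ne hne with hlt | hlt
      · refine ⟨hlt, by_contra fun h0 => ?_⟩
        have h1 := weight_step_of_lt h (k := 0) (by simp) a hp hq hlt
        rw [if_pos h0] at h1
        omega
      · have h1 := weight_step_of_gt h (k := 0) (by simp) a hp hq hlt
        rw [if_neg (by simp [stepExp, genExp_zero, ih])] at h1
        omega
  obtain ⟨m, rfl⟩ := Nat.exists_eq_add_of_le' (show 1 ≤ n by omega)
  have hσ : σ = 1 := by
    rw [← inv_eq_one]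
    exact Perm.eq_one_of_strictMono
      (Fin.strictMono_iff_lt_succ.mpr fun i => (key i.val (by omega)).1)
  refine hne ⟨hσ, ?_⟩
  have hs : ∀ i : Fin m, a i.succ = 0 := fun i => by
    have := (key i.val (by omega)).2
    rw [hσ] at this
    exact this
  rw [Fin.sum_univ_succ] at ha
  funext i
  refine Fin.cases ?_ hs i
  simpa [hs] using ha

lemma weight_le_length (hn : 2 ≤ n) (L : List (Matrix (Fin n) (Fin n) (RatFunc ℚ)))
    (hL : ∀ g ∈ L, g ∈ Xset n) :
    ∃ σ a, L.prod = monoMat σ a ∧ weight σ a ≤ L.length := by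
  induction L using List.reverseRecOn with
  | nil => exact ⟨1, 0, by rw [monoMat_one_zero, List.prod_nil], by simp [weight_one_zero]⟩
  | append_singleton L g ih =>
    obtain ⟨σ, a, h1, h2⟩ := ih fun g hg => hL g (by simp [hg])
    obtain ⟨c, h, k, hk, rfl⟩ := (mem_Xset_iff hn g).mp (hL g (by simp))
    refine ⟨stepPerm c h σ, stepExp k σ a, ?_, ?_⟩
    · rw [List.prod_append, List.prod_singleton, h1, monoMat_mul_genMat]
    · have := weight_step_le h hk σ a
      simp only [List.length_append, List.length_singleton]
      omega

lemma exists_word (hn : 2 ≤ n) (m : ℕ) : ∀ (σ : Perm (Fin n)) (a : Fin n → ℤ), ∑ i, a i = 0 →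
    weight σ a = m → ∃ L : List (Matrix (Fin n) (Fin n) (RatFunc ℚ)),
      L.length = m ∧ (∀ g ∈ L, g ∈ Xset n) ∧ L.prod = monoMat σ a := by
  induction m with
  | zero =>
    intro σ a ha hw
    by_cases h1 : σ = 1 ∧ a = 0
    · obtain ⟨rfl, rfl⟩ := h1
      exact ⟨[], by simp, by simp, by rw [monoMat_one_zero, List.prod_nil]⟩
    · obtain ⟨c, h, k, -, h2⟩ := exists_descent hn σ a ha h1
      omega
  | succ m ih =>
    intro σ a ha hw
    have h1 : ¬ (σ = 1 ∧ a = 0) := by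
      rintro ⟨rfl, rfl⟩
      rw [weight_one_zero] at hw
      omega
    obtain ⟨c, h, k, hk, h2⟩ := exists_descent hn σ a ha h1
    obtain ⟨L, hl, hX, hp⟩ := ih (stepPerm c h σ) (stepExp k σ a)
      (by rw [sum_stepExp hn, ha]) (by omega)
    refine ⟨L ++ [genMat c h k], by simp [hl], ?_, ?_⟩
    · intro g hg
      rcases List.mem_append.mp hg with hg | hg
      · exact hX g hg
      · rw [List.mem_singleton.mp hg]
        exact (mem_Xset_iff hn _).mpr ⟨c, h, k, hk, rfl⟩
    · rw [List.prod_append, List.prod_singleton, hp, ← monoMat_mul_genMat, mul_assoc,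
        genMat_mul_self h hk, mul_one]

lemma monoMat_injective {σ τ : Perm (Fin n)} {a b : Fin n → ℤ} (h : monoMat σ a = monoMat τ b) :
    σ = τ ∧ a = b := by
  have h1 : ∀ r, σ r = τ r := by
    intro r
    have := congrFun (congrFun h r) (σ r)
    by_contra hne
    simp [monoMat, hne, xx_zpow_ne_zero] at this
  refine ⟨Equiv.ext h1, funext fun r => ?_⟩
  have h2 := congrFun (congrFun h r) (σ r)
  simp only [monoMat, h1, if_true] at h2
  have h3 : xx ^ (a r - b r) = 1 := by
    rw [zpow_sub₀ xx_ne_zero, h2, div_self (xx_zpow_ne_zero _)]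
  have := xx_zpow_eq_one h3
  omega

lemma len_monoMat (hn : 2 ≤ n) (σ : Perm (Fin n)) (a : Fin n → ℤ) (ha : ∑ i, a i = 0) :
    len n (monoMat σ a) = weight σ a := by
  apply le_antisymm
  · exact Nat.sInf_le (exists_word hn _ σ a ha rfl)
  · refine le_csInf ⟨_, exists_word hn _ σ a ha rfl⟩ ?_
    rintro m ⟨L, rfl, hX, hp⟩
    obtain ⟨τ, b, h1, h2⟩ := weight_le_length hn L hX
    obtain ⟨rfl, rfl⟩ := monoMat_injective (hp.symm.trans h1)
    exact h2

lemma prod_reverse_eq_inv (hn : 2 ≤ n) (L : List (Matrix (Fin n) (Fin n) (RatFunc ℚ)))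
    (hL : ∀ g ∈ L, g ∈ Xset n) : L.reverse.prod = L.prod⁻¹ := by
  symm
  apply Matrix.inv_eq_left_inv
  induction L with
  | nil => simp
  | cons g L ih =>
    obtain ⟨c, h, k, hk, rfl⟩ := (mem_Xset_iff hn g).mp (hL g (by simp))
    rw [List.reverse_cons, List.prod_append, List.prod_singleton, List.prod_cons, mul_assoc,
      ← mul_assoc (genMat c h k), genMat_mul_self h hk, one_mul]
    exact ih fun g hg => hL g (by simp [hg])

lemma len_inv (hn : 2 ≤ n) {w : Matrix (Fin n) (Fin n) (RatFunc ℚ)} (hw : w⁻¹⁻¹ = w) :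
    len n w⁻¹ = len n w := by
  have key : ∀ {u : Matrix (Fin n) (Fin n) (RatFunc ℚ)} {m : ℕ},
      (∃ L : List (Matrix (Fin n) (Fin n) (RatFunc ℚ)),
        L.length = m ∧ (∀ a ∈ L, a ∈ Xset n) ∧ L.prod = u) →
      ∃ L : List (Matrix (Fin n) (Fin n) (RatFunc ℚ)),
        L.length = m ∧ (∀ a ∈ L, a ∈ Xset n) ∧ L.prod = u⁻¹ := by
    rintro u m ⟨L, rfl, hX, rfl⟩
    exact ⟨L.reverse, by simp, by simpa using hX, prod_reverse_eq_inv hn L hX⟩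
  unfold len
  congr 1
  ext m
  refine ⟨fun h => ?_, key⟩
  have := key h
  rwa [hw] at this

lemma sum_pairs (n : ℕ) : ∑ p : Fin n × Fin n, (if p.1 < p.2 then 2 else 0) = n * (n - 1) := by
  rw [Fintype.sum_prod_type_right]
  have : ∀ y : Fin n, ∑ x : Fin n, (if x < y then 2 else 0) = y.val * 2 := by
    intro y
    rw [← Finset.sum_filter, Finset.sum_const, smul_eq_mul]
    congr 1
    rw [Finset.filter_gt_eq_Iio, Fin.card_Iio]
  simp only [this]
  rw [← Finset.sum_mul, Fin.sum_univ_eq_sum_range (fun i => i), Finset.sum_range_id_mul_two]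

lemma weight_eq_max_iff (σ : Perm (Fin n)) (a : Fin n → ℤ) :
    weight σ a = n * (n - 1) ↔ σ = 1 ∧ ∀ i : Fin n, i.val ≠ 0 → a i ≠ 0 := by
  rw [← sum_pairs, weight, Finset.sum_eq_sum_iff_of_le]
  · constructor
    · intro h
      have h1 : ∀ i j : Fin n, i < j → σ i < σ j ∧ a j ≠ 0 := by
        intro i j hij
        have := h (i, j) (Finset.mem_univ _)
        have hne : σ i ≠ σ j := fun e => hij.ne (σ.injective e)
        simp only [pairWeight, if_pos hij] at this
        split_ifs at this with h2 h3 <;> omega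
      refine ⟨Perm.eq_one_of_strictMono fun i j hij => (h1 i j hij).1, fun i hi => ?_⟩
      exact (h1 ⟨0, by omega⟩ i (Fin.lt_def.mpr (by simp; omega))).2
    · rintro ⟨rfl, h⟩ ⟨i, j⟩ -
      simp only [pairWeight, Perm.one_apply]
      by_cases hij : i < j
      · have := h j (by rw [Fin.lt_def] at hij; omega)
        simp [hij, hij.le, this]
      · simp [hij]
  · intro p _
    simp only [pairWeight]
    split_ifs <;> simp

lemma weight_add_weight_eq_max_iff (σ : Perm (Fin n)) (a d : Fin n → ℤ)
    (hd : ∀ i j, i < j → σ i < σ j → d j ≠ 0) :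
    weight σ a + weight σ (a - d) = n * (n - 1) ↔
      ∀ i j, i < j → σ i < σ j → a j = 0 ∨ a j = d j := by
  rw [← sum_pairs, weight, weight, ← Finset.sum_add_distrib, eq_comm,
    Finset.sum_eq_sum_iff_of_le]
  · constructor
    · intro h i j hij hs
      have := h (i, j) (Finset.mem_univ _)
      simp only [pairWeight, if_pos hij, if_neg hs.not_gt, Pi.sub_apply] at this
      by_contra! hc
      rw [if_pos hc.1, if_pos (sub_ne_zero.mpr hc.2)] at this
      omega
    · rintro h ⟨i, j⟩ -
      simp only [pairWeight, Pi.sub_apply]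
      by_cases hij : i < j
      swap
      · simp [hij]
      by_cases hs : σ j < σ i
      · simp [hij, hs]
      have hs' : σ i < σ j :=
        lt_of_le_of_ne (not_lt.mp hs) fun e => hij.ne (σ.injective e)
      have := hd i j hij hs'
      rcases h i j hij hs' with h | h <;> simp [hij, hs, h, this]
  · rintro ⟨i, j⟩ -
    simp only [pairWeight, Pi.sub_apply]
    by_cases hij : i < j
    swap
    · simp [hij]
    by_cases hs : σ j < σ i
    · simp [hij, hs]
    have := hd i j hij (lt_of_le_of_ne (not_lt.mp hs) fun e => hij.ne (σ.injective e))
    simp only [hij, hs, if_true, if_false]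
    split_ifs <;> omega

lemma preL_monoMat_iff (hn : 2 ≤ n) (σ : Perm (Fin n)) (a b : Fin n → ℤ) (ha : ∑ i, a i = 0)
    (hb : ∑ i, b i = 0) (hb0 : ∀ i : Fin n, i.val ≠ 0 → b i ≠ 0) :
    preL n (monoMat σ a) (monoMat 1 b) ↔ ∀ i j, i < j → σ i < σ j → a j = 0 ∨ a j = b j := by
  have h1 : ((monoMat σ a)⁻¹ * monoMat 1 b) = (monoMat σ (a - b))⁻¹ := by
    rw [monoMat_inv, monoMat_inv, monoMat_mul]
    congr 1
    funext r
    simp only [Pi.sub_apply]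
    ring
  have h2 : (monoMat σ (a - b))⁻¹⁻¹ = monoMat σ (a - b) := by
    rw [monoMat_inv, monoMat_inv, inv_inv]
    congr 1
    funext r
    simp
  have h3 : weight 1 b = n * (n - 1) := (weight_eq_max_iff 1 b).mpr ⟨rfl, hb0⟩
  rw [preL, h1, len_inv hn h2, len_monoMat hn _ _ ha, len_monoMat hn _ _ hb,
    len_monoMat hn _ _ (by simp [ha, hb]), h3]
  exact weight_add_weight_eq_max_iff σ a b fun i j hij _ => hb0 j (by
    rw [Fin.lt_def] at hij; omega)

lemma preR_monoMat_iff (hn : 2 ≤ n) (σ : Perm (Fin n)) (a b : Fin n → ℤ) (ha : ∑ i, a i = 0)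
    (hb : ∑ i, b i = 0) (hb0 : ∀ i : Fin n, i.val ≠ 0 → b i ≠ 0) :
    preR n (monoMat σ a) (monoMat 1 b) ↔
      ∀ i j, i < j → σ i < σ j → a j = 0 ∨ a j = b (σ j) := by
  have h1 : (monoMat 1 b * (monoMat σ a)⁻¹) = (monoMat σ (a - b ∘ σ))⁻¹ := by
    rw [monoMat_inv, monoMat_inv, monoMat_mul]
    congr 1
    funext r
    simp only [Pi.sub_apply, Function.comp_apply, Perm.one_apply, Equiv.Perm.coe_inv, Equiv.apply_symm_apply]
    ring
  have h2 : (monoMat σ (a - b ∘ σ))⁻¹⁻¹ = monoMat σ (a - b ∘ σ) := by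
    rw [monoMat_inv, monoMat_inv, inv_inv]
    congr 1
    funext r
    simp
  have h3 : weight 1 b = n * (n - 1) := (weight_eq_max_iff 1 b).mpr ⟨rfl, hb0⟩
  have h4 : ∑ i, b (σ i) = 0 := by rw [Equiv.sum_comp σ b, hb]
  rw [preR, h1, len_inv hn h2, len_monoMat hn _ _ ha, len_monoMat hn _ _ hb,
    len_monoMat hn _ _ (by simp [ha, h4]), h3, add_comm]
  exact weight_add_weight_eq_max_iff σ a (b ∘ σ) fun i j _ hs => hb0 (σ j) (by
    rw [Fin.lt_def] at hs; omega)

/-- The exponents of `λ ^ k`. -/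
def lamExp (n : ℕ) (k : ℤ) : Fin n → ℤ :=
  fun i => if i.val = 0 then -((n : ℤ) - 1) * k else k

lemma lam_eq (n : ℕ) : lam n = monoMat 1 (lamExp n 1) := by
  rw [monoMat_one_eq_diagonal, lam]
  congr 1
  funext i
  simp only [lamExp]
  split_ifs <;> simp

lemma lam_pow (n m : ℕ) : lam n ^ m = monoMat 1 (lamExp n m) := by
  rw [lam_eq, monoMat_one_eq_diagonal, monoMat_one_eq_diagonal, Matrix.diagonal_pow]
  congr 1
  funext i
  rw [Pi.pow_apply, ← zpow_natCast, ← zpow_mul]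
  congr 1
  simp only [lamExp]
  split_ifs <;> ring

lemma lam_zpow (n : ℕ) (k : ℤ) : lam n ^ k = monoMat 1 (lamExp n k) := by
  obtain ⟨m, rfl | rfl⟩ := Int.eq_nat_or_neg k
  · rw [zpow_natCast, lam_pow]
  · rw [Matrix.zpow_neg_natCast, lam_pow, monoMat_inv, inv_one]
    congr 1
    funext i
    by_cases hi : i.val = 0
    · simp only [lamExp, Perm.one_apply, hi, if_true]
      ring
    · simp [lamExp, hi]

lemma sum_lamExp (hn : 2 ≤ n) (k : ℤ) : ∑ i, lamExp n k i = 0 := by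
  obtain ⟨m, rfl⟩ := Nat.exists_eq_add_of_le' (show 1 ≤ n by omega)
  simp [Fin.sum_univ_succ, lamExp]

lemma eq_lamExp (hn : 2 ≤ n) {b : Fin n → ℤ} (hb : ∑ i, b i = 0) {k : ℤ}
    (h : ∀ i : Fin n, i.val ≠ 0 → b i = k) : b = lamExp n k := by
  obtain ⟨m, rfl⟩ := Nat.exists_eq_add_of_le' (show 1 ≤ n by omega)
  have hs : ∀ i : Fin m, b i.succ = k := fun i => h _ (by simp)
  funext i
  refine Fin.cases ?_ (fun i => by simp [lamExp, hs]) i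
  simp only [Fin.sum_univ_succ, hs, Finset.sum_const, Finset.card_univ, Fintype.card_fin,
    nsmul_eq_mul] at hb
  simp [lamExp]
  linarith

lemma exps_eq_of_balanced (hn : 2 ≤ n) {b : Fin n → ℤ} (hb : ∑ i, b i = 0)
    (hb0 : ∀ i : Fin n, i.val ≠ 0 → b i ≠ 0)
    (hbal : ∀ v, IsGinf n v → (preL n v (monoMat 1 b) ↔ preR n v (monoMat 1 b)))
    {i m : Fin n} (hi : i.val ≠ 0) (hm : m.val ≠ 0) : b i = b m := by
  let z : Fin n := ⟨0, by omega⟩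
  have hzi : z ≠ i := fun e => hi (by rw [← e])
  have hzm : z ≠ m := fun e => hm (by rw [← e])
  let a : Fin n → ℤ := Pi.single i (b i) - Pi.single z (b i)
  have ha : ∑ j, a j = 0 := by simp [a]
  have h := hbal _ (isGinf_monoMat (swap i m) a ha)
  rw [preL_monoMat_iff hn _ _ _ ha hb hb0, preR_monoMat_iff hn _ _ _ ha hb hb0] at h
  have h1 := h.mp (fun p j hpj _ => by
    have hjz : j ≠ z := by
      rintro rfl
      exact absurd hpj (by simp [Fin.lt_def, z])
    by_cases hj : j = i
    · right
      simp [a, hj, hzi.symm]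
    · left
      simp [a, hj, hjz]) z i (by rw [Fin.lt_def]; exact Nat.pos_of_ne_zero hi)
    (by rw [swap_apply_of_ne_of_ne hzi hzm, swap_apply_left, Fin.lt_def]
        exact Nat.pos_of_ne_zero hm)
  simpa [a, hzi.symm, hb0 i hi] using h1

/-- the balanced elements of maximal length `n(n-1)` are exactly the `λ^k`,
`k ∈ ℤ`, `k ≠ 0`.  (`w` balanced: `[1,w] = [1,w]_r` as subsets of `G(∞,∞,n)`.) -/
theorem stmt_5 (n : ℕ) (hn : 2 ≤ n) (w : Matrix (Fin n) (Fin n) (RatFunc ℚ))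
    (hw : IsGinf n w) :
    ((∀ v : Matrix (Fin n) (Fin n) (RatFunc ℚ), IsGinf n v → (preL n v w ↔ preR n v w)) ∧
        len n w = n * (n - 1)) ↔
      ∃ k : ℤ, k ≠ 0 ∧ w = (lam n) ^ k := by
  constructor
  · rintro ⟨hbal, hlen⟩
    obtain ⟨σ, b, hb, rfl⟩ := hw.exists_monoMat
    rw [len_monoMat hn _ _ hb] at hlen
    obtain ⟨rfl, hb0⟩ := (weight_eq_max_iff σ b).mp hlen
    have h1 : (⟨1, hn⟩ : Fin n).val ≠ 0 := one_ne_zero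
    refine ⟨b ⟨1, hn⟩, hb0 _ h1, ?_⟩
    rw [lam_zpow]
    exact congrArg _ (eq_lamExp hn hb fun i hi => exps_eq_of_balanced hn hb hb0 hbal hi h1)
  · rintro ⟨k, hk, rfl⟩
    have hne : ∀ i : Fin n, i.val ≠ 0 → lamExp n k i = k := fun i hi => by simp [lamExp, hi]
    have h0 : ∀ i : Fin n, i.val ≠ 0 → lamExp n k i ≠ 0 := fun i hi => by rwa [hne i hi]
    have hs := sum_lamExp hn k
    rw [lam_zpow]
    refine ⟨fun v hv => ?_, ?_⟩
    · obtain ⟨σ, a, ha, rfl⟩ := hv.exists_monoMat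
      rw [preL_monoMat_iff hn _ _ _ ha hs h0, preR_monoMat_iff hn _ _ _ ha hs h0]
      refine forall₄_congr fun i j hij hσ => ?_
      rw [Fin.lt_def] at hij hσ
      rw [hne j (by omega), hne (σ j) (by omega)]
    · rw [len_monoMat hn _ _ hs]
      exact (weight_eq_max_iff _ _).mpr ⟨rfl, h0⟩
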